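/- If u ∈ W^{s,p}(ℝ) with p > 1 and s > 1/p, and u(0) = 0, then ∫_ℝ |u(v)/v| dv ≤ C ‖u‖_{W^{s,p}(ℝ)} for some constant C depending only on s and p. -/

import Mathlib

open MeasureTheory Set
open scoped ENNReal NNReal

/-- The fractional Sobolev `W^{s,p}(ℝ)` norm, defined (for `0 < s < 1`) as the `L^p` norm
plus the Gagliardo seminorm, valued in `ℝ≥0∞`. -/
noncomputable def fracSobolevNorm (s p : ℝ) (u : ℝ → ℝ) : ℝ≥0∞ :=
  (∫⁻ x : ℝ, ENNReal.ofReal (|u x| ^ p)) ^ (1 / p) +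
    (∫⁻ x : ℝ, ∫⁻ y : ℝ,
      ENNReal.ofReal (|u x - u y| ^ p / |x - y| ^ (1 + s * p))) ^ (1 / p)

open ProbabilityTheory Filter Topology

/-- Jensen's inequality for `t ↦ t ^ p` and a probability measure. -/
lemma lintegral_le_rpow_lintegral_rpow {α : Type*} [MeasurableSpace α] (μ : Measure α)
    [IsProbabilityMeasure μ] {p : ℝ} (hp : 1 < p) {f : α → ℝ≥0∞} (hf : Measurable f) :
    ∫⁻ a, f a ∂μ ≤ (∫⁻ a, f a ^ p ∂μ) ^ (1 / p) := by
  simpa using ENNReal.lintegral_mul_le_Lp_mul_Lq μ (Real.HolderConjugate.conjExponent hp)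
    hf.aemeasurable (g := fun _ => 1) aemeasurable_const

/-- Two means of `|u|` differ by at most the `L^p` mean of the increments of `u`. -/
lemma lintegral_abs_le_add_increments (α β : Measure ℝ) [IsProbabilityMeasure α]
    [IsProbabilityMeasure β] {p : ℝ} (hp : 1 < p) {u : ℝ → ℝ} (hu : Measurable u) :
    ∫⁻ x, ENNReal.ofReal |u x| ∂α ≤ ∫⁻ y, ENNReal.ofReal |u y| ∂β +
      (∫⁻ x, ∫⁻ y, ENNReal.ofReal (|u x - u y| ^ p) ∂β ∂α) ^ (1 / p) := by
  have hp0 : 0 < p := by linarith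
  have hm : Measurable fun z : ℝ × ℝ => ENNReal.ofReal |u z.1 - u z.2| := by fun_prop
  have hm1 (x : ℝ) : Measurable fun y : ℝ => ENNReal.ofReal |u x - u y| := by fun_prop
  have hm2 : Measurable fun x : ℝ => ∫⁻ y, ENNReal.ofReal |u x - u y| ∂β :=
    hm.lintegral_prod_right'
  calc ∫⁻ x, ENNReal.ofReal |u x| ∂α
      ≤ ∫⁻ x, (∫⁻ y, ENNReal.ofReal |u y| ∂β + ∫⁻ y, ENNReal.ofReal |u x - u y| ∂β) ∂α := by
        refine lintegral_mono fun x => ?_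
        rw [← lintegral_add_right _ (hm1 x)]
        calc ENNReal.ofReal |u x| = ∫⁻ _, ENNReal.ofReal |u x| ∂β := by simp
          _ ≤ _ := by
            refine lintegral_mono fun y => ?_
            rw [← ENNReal.ofReal_add (abs_nonneg _) (abs_nonneg _)]
            refine ENNReal.ofReal_le_ofReal ?_
            simpa using abs_add_le (u y) (u x - u y)
    _ = ∫⁻ y, ENNReal.ofReal |u y| ∂β + ∫⁻ x, ∫⁻ y, ENNReal.ofReal |u x - u y| ∂β ∂α := by
        rw [lintegral_add_right _ hm2]; simp
    _ ≤ _ := by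
        gcongr
        refine (lintegral_le_rpow_lintegral_rpow α hp hm2).trans ?_
        gcongr with x
        calc (∫⁻ y, ENNReal.ofReal |u x - u y| ∂β) ^ p
            ≤ ((∫⁻ y, ENNReal.ofReal |u x - u y| ^ p ∂β) ^ (1 / p)) ^ p := by
              gcongr
              exact lintegral_le_rpow_lintegral_rpow β hp (hm1 x)
          _ = ∫⁻ y, ENNReal.ofReal (|u x - u y| ^ p) ∂β := by
              rw [← ENNReal.rpow_mul, one_div_mul_cancel hp0.ne', ENNReal.rpow_one]
              simp only [ENNReal.ofReal_rpow_of_nonneg (abs_nonneg _) hp0.le]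

/-- The symmetric annulus `r / 2 < |x| ≤ r` in the real line. -/
def annulus (r : ℝ) : Set ℝ := {x | r / 2 < |x| ∧ |x| ≤ r}

lemma annulus_eq_sdiff (r : ℝ) :
    annulus r = Metric.closedBall 0 r \ Metric.closedBall 0 (r / 2) := by
  ext x
  simp [annulus, and_comm]

lemma measurableSet_annulus (r : ℝ) : MeasurableSet (annulus r) := by
  rw [annulus_eq_sdiff]
  exact measurableSet_closedBall.diff measurableSet_closedBall

lemma volume_annulus {r : ℝ} (hr : 0 < r) : volume (annulus r) = ENNReal.ofReal r := by
  rw [annulus_eq_sdiff, measure_sdiff (Metric.closedBall_subset_closedBall (by linarith))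
    measurableSet_closedBall.nullMeasurableSet measure_closedBall_lt_top.ne,
    Real.volume_closedBall, Real.volume_closedBall, ← ENNReal.ofReal_sub _ (by linarith)]
  congr 1
  ring

lemma isProbabilityMeasure_cond_annulus {r : ℝ} (hr : 0 < r) :
    IsProbabilityMeasure (volume[|annulus r]) :=
  cond_isProbabilityMeasure_of_finite (by simp [volume_annulus hr, hr])
    (by simp [volume_annulus hr])

/-- The `L^p` mean of the increments of `u` between consecutive annuli is controlled by the
Gagliardo seminorm. -/
lemma lintegral_increments_annulus_le {p s r : ℝ} (hp : 1 < p) (hs : 0 < s) (hr : 0 < r)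
    (u : ℝ → ℝ) :
    ∫⁻ x, ∫⁻ y, ENNReal.ofReal (|u x - u y| ^ p) ∂volume[|annulus (r / 2)] ∂volume[|annulus r] ≤
      ENNReal.ofReal (2 / r ^ 2 * (2 * r) ^ (1 + s * p)) *
        ∫⁻ x, ∫⁻ y, ENNReal.ofReal (|u x - u y| ^ p / |x - y| ^ (1 + s * p)) := by
  have hp0 : 0 < p := by linarith
  have hr2 : 0 < r / 2 := by linarith
  have he : 0 < 1 + s * p := by positivity
  set c := ENNReal.ofReal ((2 * r) ^ (1 + s * p)) with hc
  have hcT : c ≠ ∞ := ENNReal.ofReal_ne_top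
  have hker : ∀ x ∈ annulus r, ∀ y ∈ annulus (r / 2), ENNReal.ofReal (|u x - u y| ^ p) ≤
      c * ENNReal.ofReal (|u x - u y| ^ p / |x - y| ^ (1 + s * p)) := by
    intro x hx y hy
    rw [hc, ← ENNReal.ofReal_mul (by positivity)]
    refine ENNReal.ofReal_le_ofReal ?_
    have hne : 0 < |x - y| := by
      have := hx.1
      have := hy.2
      have := abs_sub_abs_le_abs_sub x y
      linarith
    have hle : |x - y| ≤ 2 * r := by
      have := hx.2
      have := hy.2
      have := abs_sub x y
      linarith
    have hpow : |x - y| ^ (1 + s * p) ≤ (2 * r) ^ (1 + s * p) :=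
      Real.rpow_le_rpow hne.le hle he.le
    have hpos : 0 < |x - y| ^ (1 + s * p) := Real.rpow_pos_of_pos hne _
    rw [mul_div_assoc', le_div_iff₀ hpos, mul_comm]
    gcongr
  simp only [ProbabilityTheory.cond, lintegral_smul_measure, smul_eq_mul]
  rw [lintegral_const_mul' _ _ (by simp [volume_annulus hr2, hr2]), volume_annulus hr,
    volume_annulus hr2, ← mul_assoc]
  have hconst : (ENNReal.ofReal r)⁻¹ * (ENNReal.ofReal (r / 2))⁻¹ * c =
      ENNReal.ofReal (2 / r ^ 2 * (2 * r) ^ (1 + s * p)) := by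
    rw [hc, ← ENNReal.ofReal_inv_of_pos hr, ← ENNReal.ofReal_inv_of_pos hr2,
      ← ENNReal.ofReal_mul (by positivity), ← ENNReal.ofReal_mul (by positivity)]
    congr 2
    field_simp
  rw [← hconst, mul_assoc _ c]
  gcongr
  calc ∫⁻ x in annulus r, ∫⁻ y in annulus (r / 2), ENNReal.ofReal (|u x - u y| ^ p)
      ≤ ∫⁻ x in annulus r, ∫⁻ y in annulus (r / 2),
          c * ENNReal.ofReal (|u x - u y| ^ p / |x - y| ^ (1 + s * p)) :=
        setLIntegral_mono' (measurableSet_annulus _) fun x hx =>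
          setLIntegral_mono' (measurableSet_annulus _) fun y hy => hker x hx y hy
    _ ≤ ∫⁻ x, ∫⁻ y, c * ENNReal.ofReal (|u x - u y| ^ p / |x - y| ^ (1 + s * p)) :=
        (setLIntegral_le_lintegral _ _).trans
          (lintegral_mono fun x => setLIntegral_le_lintegral _ _)
    _ = _ := by simp only [lintegral_const_mul' _ _ hcT]

lemma rpow_dyadic_constant {p s : ℝ} (hp : 0 < p) (k : ℕ) :
    (2 / ((1 / 2 : ℝ) ^ k) ^ 2 * (2 * (1 / 2) ^ k) ^ (1 + s * p)) ^ (1 / p) =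
      (2 ^ (2 + s * p)) ^ (1 / p) * ((1 / 2) ^ (s - 1 / p)) ^ k := by
  have h2 : (0 : ℝ) < 2 := by norm_num
  have hk : ((1 / 2 : ℝ)) ^ k = 2 ^ (-(k : ℝ)) := by
    rw [Real.rpow_neg h2.le, Real.rpow_natCast, one_div, inv_pow]
  have hh : (1 / 2 : ℝ) ^ (s - 1 / p) = 2 ^ (-(s - 1 / p)) := by
    rw [Real.rpow_neg h2.le, one_div, Real.inv_rpow h2.le]
  have h3 : 2 / ((2 : ℝ) ^ (-(k : ℝ))) ^ 2 = 2 ^ (1 + 2 * (k : ℝ)) := by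
    rw [← Real.rpow_natCast (2 ^ (-(k : ℝ))), ← Real.rpow_mul h2.le]
    nth_rewrite 1 [← Real.rpow_one 2]
    rw [← Real.rpow_sub h2]
    congr 1
    push_cast
    ring
  have h4 : 2 * (2 : ℝ) ^ (-(k : ℝ)) = 2 ^ (1 - (k : ℝ)) := by
    rw [sub_eq_add_neg, Real.rpow_add h2, Real.rpow_one]
  rw [hk, hh, h3, h4, ← Real.rpow_natCast, ← Real.rpow_mul h2.le, ← Real.rpow_mul h2.le,
    ← Real.rpow_mul h2.le, ← Real.rpow_add h2, ← Real.rpow_mul h2.le, ← Real.rpow_add h2]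
  congr 1
  field_simp
  ring

/-- The mean of `|u|` over the `k`-th dyadic annulus. -/
noncomputable def dyadicMean (u : ℝ → ℝ) (k : ℕ) : ℝ≥0∞ :=
  ∫⁻ x, ENNReal.ofReal |u x| ∂volume[|annulus ((1 / 2) ^ k)]

/-- The Gagliardo seminorm on the real line. -/
noncomputable def gagliardoSeminorm (s p : ℝ) (u : ℝ → ℝ) : ℝ≥0∞ :=
  (∫⁻ x : ℝ, ∫⁻ y : ℝ,
    ENNReal.ofReal (|u x - u y| ^ p / |x - y| ^ (1 + s * p))) ^ (1 / p)

lemma dyadicMean_le_succ_add {p s : ℝ} (hp : 1 < p) (hs : 0 < s) {u : ℝ → ℝ}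
    (hu : Measurable u) (k : ℕ) :
    dyadicMean u k ≤ dyadicMean u (k + 1) +
      ENNReal.ofReal ((2 ^ (2 + s * p)) ^ (1 / p)) * gagliardoSeminorm s p u *
        ENNReal.ofReal ((1 / 2) ^ (s - 1 / p)) ^ k := by
  have hp0 : 0 < p := by linarith
  have hr : (0 : ℝ) < (1 / 2) ^ k := by positivity
  have hr2 : (0 : ℝ) < (1 / 2) ^ k / 2 := by positivity
  have := isProbabilityMeasure_cond_annulus hr
  have := isProbabilityMeasure_cond_annulus hr2
  have hsucc : (1 / 2 : ℝ) ^ (k + 1) = (1 / 2) ^ k / 2 := by ring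
  rw [dyadicMean, dyadicMean, hsucc]
  refine (lintegral_abs_le_add_increments (volume[|annulus ((1 / 2) ^ k)])
    (volume[|annulus ((1 / 2) ^ k / 2)]) hp hu).trans ?_
  gcongr
  refine (ENNReal.rpow_le_rpow (lintegral_increments_annulus_le hp hs hr u)
    (by positivity)).trans_eq ?_
  rw [ENNReal.mul_rpow_of_nonneg _ _ (by positivity),
    ENNReal.ofReal_rpow_of_nonneg (by positivity) (by positivity), rpow_dyadic_constant hp0,
    ENNReal.ofReal_mul (by positivity), ENNReal.ofReal_pow (by positivity), gagliardoSeminorm]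
  ring

lemma tendsto_dyadicMean {u : ℝ → ℝ} (hu : ContinuousAt u 0) (h0 : u 0 = 0) :
    Tendsto (dyadicMean u) atTop (𝓝 0) := by
  rw [ENNReal.tendsto_nhds_zero]
  intro ε hε
  have hcont : Tendsto (fun x => ENNReal.ofReal |u x|) (𝓝 0) (𝓝 0) := by
    have : ContinuousAt (fun x => ENNReal.ofReal |u x|) 0 :=
      ENNReal.continuous_ofReal.continuousAt.comp hu.abs
    simpa [ContinuousAt, h0] using this
  obtain ⟨δ, hδ, hball⟩ := Metric.eventually_nhds_iff.1 (ENNReal.tendsto_nhds_zero.1 hcont ε hε)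
  have hpow : Tendsto (fun k : ℕ => (1 / 2 : ℝ) ^ k) atTop (𝓝 0) :=
    tendsto_pow_atTop_nhds_zero_of_lt_one (by norm_num) (by norm_num)
  filter_upwards [hpow.eventually_lt_const hδ] with k hk
  have hr : (0 : ℝ) < (1 / 2) ^ k := by positivity
  have := isProbabilityMeasure_cond_annulus hr
  calc dyadicMean u k ≤ ∫⁻ _, ε ∂volume[|annulus ((1 / 2) ^ k)] := by
        refine lintegral_mono_ae ?_
        filter_upwards [ae_cond_mem (measurableSet_annulus _)] with x hx
        exact hball (by simpa using hx.2.trans_lt hk)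
    _ = ε := by rw [lintegral_const, measure_univ, mul_one]

lemma le_tsum_of_le_succ_add {b d : ℕ → ℝ≥0∞} (h : ∀ k, b k ≤ b (k + 1) + d k)
    (hb : Tendsto b atTop (𝓝 0)) (k : ℕ) : b k ≤ ∑' i, d (k + i) := by
  have hn (n : ℕ) : b k ≤ b (n + k) + ∑ i ∈ Finset.range n, d (k + i) := by
    induction n with
    | zero => simp
    | succ n ih =>
      refine ih.trans ?_
      rw [Finset.sum_range_succ]
      calc b (n + k) + ∑ i ∈ Finset.range n, d (k + i)
          ≤ (b (n + k + 1) + d (n + k)) + ∑ i ∈ Finset.range n, d (k + i) := by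
            gcongr
            exact h _
        _ = _ := by
            rw [show n + 1 + k = n + k + 1 by ring, add_comm n k]
            ring
  have hlim : Tendsto (fun n => b (n + k) + ∑' i, d (k + i)) atTop (𝓝 (0 + ∑' i, d (k + i))) :=
    ((tendsto_add_atTop_iff_nat k).2 hb).add tendsto_const_nhds
  rw [zero_add] at hlim
  refine ge_of_tendsto' hlim fun n => (hn n).trans ?_
  gcongr
  exact ENNReal.sum_le_tsum _

lemma tsum_dyadicMean_le {p s : ℝ} (hp : 1 < p) (hs : 0 < s) {u : ℝ → ℝ}
    (hu : Continuous u) (h0 : u 0 = 0) :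
    ∑' k, dyadicMean u k ≤
      ENNReal.ofReal ((2 ^ (2 + s * p)) ^ (1 / p)) * gagliardoSeminorm s p u *
        ((1 - ENNReal.ofReal ((1 / 2) ^ (s - 1 / p)))⁻¹ *
          (1 - ENNReal.ofReal ((1 / 2) ^ (s - 1 / p)))⁻¹) := by
  set K := ENNReal.ofReal ((2 ^ (2 + s * p)) ^ (1 / p)) * gagliardoSeminorm s p u
  set ρ := ENNReal.ofReal ((1 / 2) ^ (s - 1 / p))
  calc ∑' k, dyadicMean u k ≤ ∑' k, ∑' i, K * ρ ^ (k + i) :=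
        ENNReal.tsum_le_tsum fun k => le_tsum_of_le_succ_add
          (dyadicMean_le_succ_add hp hs hu.measurable) (tendsto_dyadicMean hu.continuousAt h0) k
    _ = _ := by
        simp only [pow_add, ENNReal.tsum_mul_left, ENNReal.tsum_mul_right, ENNReal.tsum_geometric]

lemma setLIntegral_annulus_abs_div_le (u : ℝ → ℝ) (k : ℕ) :
    ∫⁻ v in annulus ((1 / 2) ^ k), ENNReal.ofReal |u v / v| ≤ 2 * dyadicMean u k := by
  have hr : (0 : ℝ) < (1 / 2) ^ k := by positivity
  set r : ℝ := (1 / 2) ^ k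
  rw [dyadicMean, ProbabilityTheory.cond, lintegral_smul_measure, smul_eq_mul, volume_annulus hr, ← mul_assoc,
    ← lintegral_const_mul' _ _ (ENNReal.mul_ne_top (by simp) (by simp [r]))]
  refine setLIntegral_mono' (measurableSet_annulus _) fun v hv => ?_
  have hv0 : 0 < |v| := lt_trans (by positivity) hv.1
  rw [← ENNReal.ofReal_inv_of_pos hr, ← ENNReal.ofReal_ofNat 2,
    ← ENNReal.ofReal_mul (by norm_num), ← ENNReal.ofReal_mul (by positivity), abs_div]
  refine ENNReal.ofReal_le_ofReal ?_
  rw [div_eq_mul_inv, mul_comm]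
  gcongr
  rw [inv_le_comm₀ hv0 (by positivity), mul_inv, inv_inv]
  linarith [hv.1]

lemma univ_subset_annuli :
    (univ : Set ℝ) ⊆ {v | 1 < |v|} ∪ ({0} ∪ ⋃ k : ℕ, annulus ((1 / 2) ^ k)) := by
  intro v _
  rcases lt_or_ge 1 |v| with h | h
  · exact Or.inl h
  rcases eq_or_ne v 0 with rfl | hv
  · exact Or.inr (Or.inl rfl)
  obtain ⟨k, hk1, hk2⟩ := exists_nat_pow_near_of_lt_one (abs_pos.2 hv) h
    (by norm_num : (0 : ℝ) < 1 / 2) (by norm_num)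
  refine Or.inr (Or.inr (mem_iUnion.2 ⟨k, ?_, hk2⟩))
  rw [pow_succ] at hk1
  linarith

/-- The contribution of `|v| > 1`, estimated by Hölder's inequality. -/
lemma setLIntegral_one_lt_abs_div_le {p q : ℝ} (hpq : p.HolderConjugate q) {u : ℝ → ℝ}
    (hu : Measurable u) :
    ∫⁻ v in {v : ℝ | 1 < |v|}, ENNReal.ofReal |u v / v| ≤
      2 * (∫⁻ v : ℝ, ENNReal.ofReal ((1 + ‖v‖) ^ (-q))) ^ (1 / q) *
        (∫⁻ x, ENNReal.ofReal (|u x| ^ p)) ^ (1 / p) := by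
  have hmeas : MeasurableSet {v : ℝ | 1 < |v|} := measurableSet_lt measurable_const (by fun_prop)
  set g : ℝ → ℝ≥0∞ := fun v => ENNReal.ofReal ((1 + ‖v‖)⁻¹) with hg
  set f : ℝ → ℝ≥0∞ := fun v => ENNReal.ofReal |u v| with hf
  have hgm : Measurable g := by fun_prop
  have hfm : Measurable f := by fun_prop
  have hbound : ∀ v ∈ {v : ℝ | 1 < |v|}, ENNReal.ofReal |u v / v| ≤ 2 * (f * g) v := by
    intro v hv
    have hv1 : 1 < |v| := hv
    rw [Pi.mul_apply, hf, hg, ← ENNReal.ofReal_ofNat 2, ← ENNReal.ofReal_mul (abs_nonneg _),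
      ← ENNReal.ofReal_mul (by norm_num), abs_div, Real.norm_eq_abs]
    refine ENNReal.ofReal_le_ofReal ?_
    rw [← div_eq_mul_inv, mul_div_assoc', div_le_div_iff₀ (by linarith) (by linarith)]
    nlinarith [abs_nonneg (u v)]
  calc ∫⁻ v in {v : ℝ | 1 < |v|}, ENNReal.ofReal |u v / v|
      ≤ ∫⁻ v in {v : ℝ | 1 < |v|}, 2 * (f * g) v := setLIntegral_mono' hmeas hbound
    _ ≤ ∫⁻ v, 2 * (f * g) v := setLIntegral_le_lintegral _ _
    _ = 2 * ∫⁻ v, (f * g) v := lintegral_const_mul _ (hfm.mul hgm)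
    _ ≤ 2 * ((∫⁻ v, f v ^ p) ^ (1 / p) * (∫⁻ v, g v ^ q) ^ (1 / q)) := by
        gcongr
        exact ENNReal.lintegral_mul_le_Lp_mul_Lq volume hpq hfm.aemeasurable hgm.aemeasurable
    _ = _ := by
        have h1 (v : ℝ) : f v ^ p = ENNReal.ofReal (|u v| ^ p) :=
          ENNReal.ofReal_rpow_of_nonneg (abs_nonneg _) hpq.nonneg
        have h2 (v : ℝ) : g v ^ q = ENNReal.ofReal ((1 + ‖v‖) ^ (-q)) := by
          rw [hg, ENNReal.ofReal_rpow_of_nonneg (by positivity) hpq.symm.nonneg,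
            Real.inv_rpow (by positivity), Real.rpow_neg (by positivity)]
        simp only [h1, h2]
        ring

/-- Hardy-type inequality: if `u ∈ W^{s,p}(ℝ)` with `p > 1`, `s > 1/p`, and `u 0 = 0`,
then `∫ |u v / v| dv ≤ C ‖u‖_{W^{s,p}}` for a constant `C` depending only on `s, p`. -/
theorem hardy_type_inequality (p s : ℝ) (hp : 1 < p) (hs : 1 / p < s) :
    ∃ C : ℝ≥0, 0 < C ∧ ∀ u : ℝ → ℝ, Continuous u → u 0 = 0 →
      ∫⁻ v : ℝ, ENNReal.ofReal (|u v / v|) ≤ (C : ℝ≥0∞) * fracSobolevNorm s p u := by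
  have hs0 : 0 < s := lt_trans (by positivity) hs
  have hpq := Real.HolderConjugate.conjExponent hp
  set q := p.conjExponent
  set ρ := ENNReal.ofReal ((1 / 2) ^ (s - 1 / p))
  set c₁ : ℝ≥0∞ := 2 * (∫⁻ v : ℝ, ENNReal.ofReal ((1 + ‖v‖) ^ (-q))) ^ (1 / q) with hc₁
  set c₂ : ℝ≥0∞ := 2 * (ENNReal.ofReal ((2 ^ (2 + s * p)) ^ (1 / p)) *
    ((1 - ρ)⁻¹ * (1 - ρ)⁻¹)) with hc₂
  have hρ : ρ < 1 := by
    rw [ENNReal.ofReal_lt_one]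
    exact Real.rpow_lt_one (by norm_num) (by norm_num) (by linarith)
  have hρ' : (1 - ρ)⁻¹ ≠ ∞ := ENNReal.inv_ne_top.2 (tsub_pos_of_lt hρ).ne'
  have hc₁T : c₁ ≠ ∞ := by
    refine ENNReal.mul_ne_top (by simp) (ENNReal.rpow_ne_top_of_nonneg
      (by simpa using hpq.symm.nonneg) (finite_integral_one_add_norm ?_).ne)
    simpa using hpq.symm.lt
  have hc₂T : c₂ ≠ ∞ := ENNReal.mul_ne_top (by simp)
    (ENNReal.mul_ne_top (by simp) (ENNReal.mul_ne_top hρ' hρ'))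
  have hC : c₁ + c₂ + 1 ≠ ∞ := by simp [hc₁T, hc₂T]
  refine ⟨(c₁ + c₂ + 1).toNNReal, ENNReal.toNNReal_pos (by simp) hC, fun u hu h0 => ?_⟩
  rw [ENNReal.coe_toNNReal hC]
  have hinner : ∫⁻ v in ⋃ k : ℕ, annulus ((1 / 2) ^ k), ENNReal.ofReal |u v / v| ≤
      c₂ * gagliardoSeminorm s p u :=
    calc _ ≤ ∑' k, ∫⁻ v in annulus ((1 / 2) ^ k), ENNReal.ofReal |u v / v| :=
          lintegral_iUnion_le _ _
      _ ≤ ∑' k, 2 * dyadicMean u k :=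
          ENNReal.tsum_le_tsum fun k => setLIntegral_annulus_abs_div_le u k
      _ = 2 * ∑' k, dyadicMean u k := ENNReal.tsum_mul_left
      _ ≤ _ := by
          grw [tsum_dyadicMean_le hp hs0 hu h0]
          exact le_of_eq (by rw [hc₂]; ring)
  calc ∫⁻ v : ℝ, ENNReal.ofReal |u v / v|
      = ∫⁻ v in univ, ENNReal.ofReal |u v / v| := by simp
    _ ≤ ∫⁻ v in {v | 1 < |v|} ∪ ({0} ∪ ⋃ k : ℕ, annulus ((1 / 2) ^ k)),
          ENNReal.ofReal |u v / v| := lintegral_mono_set univ_subset_annuli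
    _ ≤ (∫⁻ v in {v | 1 < |v|}, ENNReal.ofReal |u v / v|) +
          ((∫⁻ v in {0}, ENNReal.ofReal |u v / v|) +
            ∫⁻ v in ⋃ k : ℕ, annulus ((1 / 2) ^ k), ENNReal.ofReal |u v / v|) := by
        grw [lintegral_union_le, lintegral_union_le]
    _ ≤ c₁ * (∫⁻ x, ENNReal.ofReal (|u x| ^ p)) ^ (1 / p) +
          (0 + c₂ * gagliardoSeminorm s p u) := by
        gcongr
        · exact setLIntegral_one_lt_abs_div_le hpq hu.measurable
        · simp
    _ ≤ (c₁ + c₂ + 1) * (∫⁻ x, ENNReal.ofReal (|u x| ^ p)) ^ (1 / p) +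
          (c₁ + c₂ + 1) * gagliardoSeminorm s p u := by
        rw [zero_add]
        gcongr
        · rw [add_assoc]
          exact le_self_add
        · rw [add_comm c₁, add_assoc]
          exact le_self_add
    _ = (c₁ + c₂ + 1) * fracSobolevNorm s p u := by
        rw [fracSobolevNorm, gagliardoSeminorm, mul_add]
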